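/- Let p be a prime and K/ℚ_p a quadratic field extension with residue degree f ∈ {1,2}. Let ω : ℚ_p^× → ℂ^× be a character of order 2 whose kernel is exactly the norm group N_{K/ℚ_p}(K^×). Then for every character χ of ℚ_p^×, one has f · a(χ ∘ N_{K/ℚ_p}) = a(χ) + a(χω) − a(ω), where χ ∘ N_{K/ℚ_p} is regarded as a character of K^×. -/

import Mathlib

/-!
Conductors of characters of `ℚ_p^×` and of `K^×` for a quadratic extension `K/ℚ_p`,
and the conductor formula for characters composed with the norm (Tunnell's Lemma 1.8):
`f · a(χ ∘ N_{K/ℚ_p}) = a(χ) + a(χω) − a(ω)`.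
-/

/-- The normalized discrete valuation on a finite extension `K` of `ℚ_p`, together with
the ramification index `e`.  (Such data exists and is unique for every finite extension.) -/
structure PadicValData (p : ℕ) [Fact p.Prime] (K : Type*) [Field K] [Algebra ℚ_[p] K] where
  /-- the normalized valuation (with junk value at `0`) -/
  v : K → ℤ
  /-- the ramification index of `K/ℚ_p` -/
  e : ℕ
  v_mul : ∀ x y : K, x ≠ 0 → y ≠ 0 → v (x * y) = v x + v y
  v_add : ∀ x y : K, x ≠ 0 → y ≠ 0 → x + y ≠ 0 → min (v x) (v y) ≤ v (x + y)
  v_surj : ∀ n : ℤ, ∃ x : K, x ≠ 0 ∧ v x = n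
  v_compat : ∀ x : ℚ_[p], x ≠ 0 → v (algebraMap ℚ_[p] K x) = (e : ℤ) * x.valuation

/-- `χ` (a character of `ℚ_p^×`) is trivial on the unit subgroup `U_p^i`. -/
def IsTrivialOnQ (p : ℕ) [Fact p.Prime] (χ : (ℚ_[p])ˣ →* ℂˣ) (i : ℕ) : Prop :=
  ∀ u : (ℚ_[p])ˣ, ‖(u : ℚ_[p])‖ = 1 → ‖(u : ℚ_[p]) - 1‖ ≤ (p : ℝ) ^ (-(i : ℤ)) → χ u = 1

/-- The conductor `a(χ)` of a character of `ℚ_p^×`. -/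
noncomputable def condQ (p : ℕ) [Fact p.Prime] (χ : (ℚ_[p])ˣ →* ℂˣ) : ℕ :=
  sInf {i | IsTrivialOnQ p χ i}

/-- `κ` (a character of `K^×`) is trivial on the higher unit group `U_K^i`. -/
def IsTrivialOnK {p : ℕ} [Fact p.Prime] {K : Type*} [Field K] [Algebra ℚ_[p] K]
    (D : PadicValData p K) (κ : Kˣ →* ℂˣ) (i : ℕ) : Prop :=
  ∀ u : Kˣ, D.v u = 0 → ((u : K) - 1 = 0 ∨ (i : ℤ) ≤ D.v ((u : K) - 1)) → κ u = 1

/-- The conductor `a(κ)` of a character of `K^×`. -/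
noncomputable def condK {p : ℕ} [Fact p.Prime] {K : Type*} [Field K] [Algebra ℚ_[p] K]
    (D : PadicValData p K) (κ : Kˣ →* ℂˣ) : ℕ :=
  sInf {i | IsTrivialOnK D κ i}

/-- `x ∈ p ^ n ℤ_p`. -/
def ValGE {p : ℕ} [Fact p.Prime] (n : ℤ) (x : ℚ_[p]) : Prop := ‖x‖ ≤ (p : ℝ) ^ (-n)

/-- `x` has `p`-adic valuation exactly `n` (and is nonzero). -/
def ValEq {p : ℕ} [Fact p.Prime] (n : ℤ) (x : ℚ_[p]) : Prop := ‖x‖ = (p : ℝ) ^ (-n)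

section Valuation

variable {p : ℕ} [Fact p.Prime] {m n : ℤ} {x y : ℚ_[p]}

lemma one_lt_prime_cast (p : ℕ) [hp : Fact p.Prime] : (1 : ℝ) < p := by
  exact_mod_cast hp.out.one_lt

lemma prime_cast_pos (p : ℕ) [Fact p.Prime] : (0 : ℝ) < p :=
  zero_lt_one.trans (one_lt_prime_cast p)

lemma ValGE.mono (h : ValGE n x) (hmn : m ≤ n) : ValGE m x :=
  le_trans h (zpow_le_zpow_right₀ (one_lt_prime_cast p).le (by omega))

lemma ValEq.valGE (h : ValEq n x) : ValGE n x := le_of_eq h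

lemma ValEq.le_of_valGE (h : ValEq n x) (h' : ValGE m x) : m ≤ n := by
  unfold ValEq at h
  unfold ValGE at h'
  rw [h, zpow_le_zpow_iff_right₀ (one_lt_prime_cast p)] at h'
  omega

lemma ValEq.unique (h : ValEq n x) (h' : ValEq m x) : m = n :=
  le_antisymm (h.le_of_valGE h'.valGE) (h'.le_of_valGE h.valGE)

lemma valGE_zero (n : ℤ) : ValGE n (0 : ℚ_[p]) := by
  unfold ValGE
  rw [norm_zero]
  exact (zpow_pos (prime_cast_pos p) _).le

lemma ValEq.ne_zero (h : ValEq n x) : x ≠ 0 := by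
  rintro rfl
  have := h.le_of_valGE (valGE_zero (n + 1))
  omega

lemma valEq_valuation (hx : x ≠ 0) : ValEq x.valuation x :=
  Padic.norm_eq_zpow_neg_valuation hx

lemma exists_valEq (hx : x ≠ 0) : ∃ n, ValEq n x := ⟨_, valEq_valuation hx⟩

lemma ValGE.add (hx : ValGE n x) (hy : ValGE n y) : ValGE n (x + y) :=
  (Padic.nonarchimedean x y).trans (max_le hx hy)

lemma ValGE.neg (hx : ValGE n x) : ValGE n (-x) := by
  unfold ValGE
  rwa [norm_neg]

lemma ValGE.sub (hx : ValGE n x) (hy : ValGE n y) : ValGE n (x - y) :=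
  sub_eq_add_neg x y ▸ hx.add hy.neg

lemma ValGE.mul (hx : ValGE m x) (hy : ValGE n y) : ValGE (m + n) (x * y) := by
  unfold ValGE at *
  rw [norm_mul, neg_add, zpow_add₀ (prime_cast_pos p).ne']
  gcongr

lemma ValEq.mul (hx : ValEq m x) (hy : ValEq n y) : ValEq (m + n) (x * y) := by
  unfold ValEq at *
  rw [norm_mul, neg_add, zpow_add₀ (prime_cast_pos p).ne', hx, hy]

lemma ValEq.neg (hx : ValEq n x) : ValEq n (-x) := by
  unfold ValEq
  rwa [norm_neg]

lemma ValEq.inv (hx : ValEq n x) : ValEq (-n) x⁻¹ := by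
  unfold ValEq at *
  rw [norm_inv, hx, zpow_neg _ (-n)]

lemma ValEq.div (hx : ValEq m x) (hy : ValEq n y) : ValEq (m - n) (x / y) := by
  rw [div_eq_mul_inv, sub_eq_add_neg]
  exact hx.mul hy.inv

lemma ValGE.div (hx : ValGE m x) (hy : ValEq n y) : ValGE (m - n) (x / y) := by
  rw [div_eq_mul_inv, sub_eq_add_neg]
  exact hx.mul hy.inv.valGE

lemma valEq_one : ValEq 0 (1 : ℚ_[p]) := by simp [ValEq]

lemma valEq_prime_zpow (p : ℕ) [Fact p.Prime] (n : ℤ) : ValEq n ((p : ℚ_[p]) ^ n) :=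
  Padic.norm_p_zpow n

lemma valEq_zero_iff : ValEq 0 x ↔ ‖x‖ = 1 := by simp [ValEq]

lemma valGE_zero_iff : ValGE 0 x ↔ ‖x‖ ≤ 1 := by simp [ValGE]

lemma ValEq.add (hx : ValEq n x) (hy : ValGE (n + 1) y) : ValEq n (x + y) := by
  have hlt : ‖y‖ < ‖x‖ := by
    unfold ValEq ValGE at *
    rw [hx]
    exact hy.trans_lt (zpow_lt_zpow_right₀ (one_lt_prime_cast p) (by omega))
  unfold ValEq
  rw [IsUltrametricDist.norm_add_eq_max_of_norm_ne_norm hlt.ne', max_eq_left hlt.le]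
  exact hx

lemma ValGE.valEq_or (h : ValGE n x) : ValEq n x ∨ ValGE (n + 1) x := by
  by_cases hx : x = 0
  · exact Or.inr (hx ▸ valGE_zero _)
  have hv := valEq_valuation hx
  rcases (hv.le_of_valGE h).eq_or_lt with h' | h'
  · exact Or.inl (h' ▸ hv)
  · exact Or.inr (hv.valGE.mono h')

lemma ValGE.of_sq (h : ValGE m (x ^ 2)) (hmn : 2 * n ≤ m + 1) : ValGE n x := by
  by_cases hx : x = 0
  · exact hx ▸ valGE_zero _
  have hv := valEq_valuation hx
  have := (sq x ▸ hv.mul hv).le_of_valGE h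
  exact hv.valGE.mono (by omega)

lemma ValGE.sq (h : ValGE n x) : ValGE (2 * n) (x ^ 2) := by
  rw [_root_.sq, two_mul]
  exact h.mul h

lemma ValEq.sq (h : ValEq n x) : ValEq (2 * n) (x ^ 2) := by
  rw [_root_.sq, two_mul]
  exact h.mul h

/-- Hensel's lemma for quadratic polynomials congruent to a linear one. -/
lemma exists_quadratic_root {α c : ℚ_[p]} (hα : ValGE 1 α) (hc : ValGE 0 c) :
    ∃ y : ℚ_[p], ValGE 0 y ∧ α * y ^ 2 + y = c := by
  have hα' : ‖α‖ < 1 := by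
    refine lt_of_le_of_lt hα ?_
    exact zpow_lt_one_of_neg₀ (one_lt_prime_cast p) (by norm_num)
  rw [valGE_zero_iff] at hc
  let A : ℤ_[p] := ⟨α, hα'.le⟩
  let C : ℤ_[p] := ⟨c, hc⟩
  let F : Polynomial ℤ_[p] := .C A * .X ^ 2 + .X - .C C
  have hA : ‖A‖ < 1 := hα'
  have hF : ∀ y, Polynomial.aeval y F = A * y ^ 2 + y - C := by
    intro y; simp [F]
  have hF' : Polynomial.aeval C (Polynomial.derivative F) = A * (2 * C) + 1 := by
    simp [F, one_add_one_eq_two]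
  have hlt : ‖A * (2 * C)‖ < 1 := by
    rw [norm_mul]
    exact mul_lt_one_of_nonneg_of_lt_one_left (norm_nonneg _) hA (PadicInt.norm_le_one _)
  have hone : ‖A * (2 * C) + 1‖ = 1 := by
    rw [IsUltrametricDist.norm_add_eq_max_of_norm_ne_norm (by rw [norm_one]; exact hlt.ne),
      norm_one, max_eq_right hlt.le]
  obtain ⟨z, hz, -⟩ := hensels_lemma (F := F) (a := C) (by
    rw [hF, hF', hone, show A * C ^ 2 + C - C = A * C ^ 2 by ring, one_pow, norm_mul]
    exact mul_lt_one_of_nonneg_of_lt_one_left (norm_nonneg _) hA (PadicInt.norm_le_one _))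
  refine ⟨z, valGE_zero_iff.2 (PadicInt.norm_le_one z), ?_⟩
  rw [hF, sub_eq_zero] at hz
  exact congrArg Subtype.val hz

lemma ValEq.sub_one_of_two {x : ℚ_[2]} (hx : ValEq 0 x) : ValGE 1 (x - 1) := by
  rw [valEq_zero_iff] at hx
  let X : ℤ_[2] := ⟨x, hx.le⟩
  have hX : PadicInt.toZMod X = 1 := by
    have h0 : PadicInt.toZMod X ≠ 0 := by
      intro h
      rw [← RingHom.mem_ker, PadicInt.ker_toZMod, IsLocalRing.mem_maximalIdeal, mem_nonunits_iff,
        PadicInt.isUnit_iff] at h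
      exact h hx
    revert h0
    generalize PadicInt.toZMod X = t
    revert t
    decide
  have hX' : X - 1 ∈ RingHom.ker (PadicInt.toZMod (p := 2)) := by
    simp [RingHom.mem_ker, hX]
  rw [PadicInt.ker_toZMod, PadicInt.maximalIdeal_eq_span_p] at hX'
  have := (PadicInt.norm_le_pow_iff_mem_span_pow (X - 1) 1).2 (by simpa using hX')
  exact_mod_cast this

lemma valEq_two_of_two : ValEq 1 (2 : ℚ_[2]) := by
  have := valEq_prime_zpow 2 1
  simpa using this

lemma valEq_two_of_ne_two (hp : p ≠ 2) : ValEq 0 (2 : ℚ_[p]) := by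
  rw [valEq_zero_iff]
  have : ‖((2 : ℕ) : ℚ_[p])‖ = 1 := by
    rw [Padic.norm_natCast_eq_one_iff, Nat.coprime_primes Fact.out Nat.prime_two]
    exact hp
  simpa using this

end Valuation

section QuadraticExtension

variable {F K : Type*} [Field F] [Field K] [Algebra F K]

lemma trace_algebraMap_of_quadratic (hK : Module.finrank F K = 2) (a : F) :
    Algebra.trace F K (algebraMap F K a) = 2 * a := by
  rw [Algebra.trace_algebraMap, hK, nsmul_eq_mul, Nat.cast_ofNat]

lemma norm_algebraMap_of_quadratic (hK : Module.finrank F K = 2) (a : F) :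
    Algebra.norm F (algebraMap F K a) = a ^ 2 := by
  rw [Algebra.norm_algebraMap, hK]

lemma trace_add_mul_of_quadratic (hK : Module.finrank F K = 2) (a b : F) (z : K) :
    Algebra.trace F K (algebraMap F K a + algebraMap F K b * z) =
      2 * a + b * Algebra.trace F K z := by
  rw [map_add, trace_algebraMap_of_quadratic hK, ← Algebra.smul_def, map_smul, smul_eq_mul]

lemma norm_add_mul_of_quadratic (hK : Module.finrank F K = 2) (a b : F) (z : K) :
    Algebra.norm F (algebraMap F K a + algebraMap F K b * z) =
      a ^ 2 + a * b * Algebra.trace F K z + b ^ 2 * Algebra.norm F z := by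
  have : Module.Finite F K := Module.finite_of_finrank_pos (by omega)
  let B := Module.finBasisOfFinrankEq F K hK
  rw [Algebra.norm_eq_matrix_det B, Algebra.norm_eq_matrix_det B, Algebra.trace_eq_matrix_trace B,
    ← Algebra.smul_def, map_add, map_smul, AlgHom.commutes]
  generalize Algebra.leftMulMatrix B z = M
  simp [Matrix.det_fin_two, Matrix.trace_fin_two, Matrix.algebraMap_matrix_apply]
  ring

lemma sq_eq_of_quadratic (hK : Module.finrank F K = 2) (z : K) :
    z ^ 2 = algebraMap F K (Algebra.trace F K z) * z - algebraMap F K (Algebra.norm F z) := by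
  have : Module.Finite F K := Module.finite_of_finrank_pos (by omega)
  let B := Module.finBasisOfFinrankEq F K hK
  apply Algebra.leftMulMatrix_injective B
  rw [Algebra.norm_eq_matrix_det B, Algebra.trace_eq_matrix_trace B,
    ← Algebra.smul_def, map_sub, map_smul, AlgHom.commutes, map_pow]
  generalize Algebra.leftMulMatrix B z = M
  ext i j
  fin_cases i <;> fin_cases j <;>
  simp [Matrix.det_fin_two, Matrix.trace_fin_two, Matrix.algebraMap_matrix_apply, sq,
    Matrix.mul_apply] <;> ring

lemma norm_one_add_of_quadratic (hK : Module.finrank F K = 2) (z : K) :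
    Algebra.norm F (1 + z) = 1 + Algebra.trace F K z + Algebra.norm F z := by
  simpa using norm_add_mul_of_quadratic hK 1 1 z

lemma exists_eq_add_mul_of_quadratic (hK : Module.finrank F K = 2) {θ : K}
    (hθ : ∀ a, algebraMap F K a ≠ θ) (z : K) :
    ∃ a b, z = algebraMap F K a + algebraMap F K b * θ := by
  have : Module.Finite F K := Module.finite_of_finrank_pos (by omega)
  have hli : LinearIndependent F ![1, θ] := by
    rw [LinearIndependent.pair_iff' one_ne_zero]
    intro a ha
    exact hθ a (by rw [← ha, Algebra.smul_def, mul_one])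
  have hspan := hli.span_eq_top_of_card_eq_finrank' (by simp [hK])
  have hz : z ∈ Submodule.span F (Set.range ![1, θ]) := hspan ▸ Submodule.mem_top
  rw [Matrix.range_cons, Matrix.range_cons, Matrix.range_empty, Set.union_empty,
    Set.singleton_union, Submodule.mem_span_pair] at hz
  obtain ⟨a, b, rfl⟩ := hz
  exact ⟨a, b, by simp [Algebra.smul_def]⟩

end QuadraticExtension

section NormValuation

variable {p : ℕ} [Fact p.Prime] {K : Type*} [Field K] [Algebra ℚ_[p] K]

/-- The trace form satisfies `|Tr z| ^ 2 ≤ |N z|`, since otherwise `z` would generate a split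
quadratic algebra. -/
lemma ValGE.trace_sq (hK : Module.finrank ℚ_[p] K = 2) {z : K} {n : ℤ}
    (h : ValGE n (Algebra.norm ℚ_[p] z)) : ValGE n (Algebra.trace ℚ_[p] K z ^ 2) := by
  by_contra hcon
  set T := Algebra.trace ℚ_[p] K z with hT
  set N := Algebra.norm ℚ_[p] z with hN
  have hT0 : T ≠ 0 := by
    intro h0
    rw [h0, zero_pow two_ne_zero] at hcon
    exact hcon (valGE_zero _)
  have hv := (valEq_valuation hT0).sq
  have hlt : 2 * T.valuation < n := by
    by_contra hle
    exact hcon (hv.valGE.mono (by omega))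
  obtain ⟨y, -, hy⟩ := exists_quadratic_root (α := -(N / T ^ 2)) (c := 1)
    ((h.div hv).neg.mono (by omega)) valEq_one.valGE
  set r := N / T * y with hr
  have hroot : r * (T - r) = N := by
    have : -N * y ^ 2 + T ^ 2 * y = T ^ 2 := by
      field_simp at hy
      linear_combination hy
    rw [hr]
    field_simp
    linear_combination N * this
  have hfac : (z - algebraMap ℚ_[p] K r) * (z - algebraMap ℚ_[p] K (T - r)) = 0 := by
    have h1 := sq_eq_of_quadratic hK z
    rw [← hT, ← hN, ← hroot] at h1
    simp only [map_mul, map_sub] at h1 ⊢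
    linear_combination h1
  have key : ∀ s : ℚ_[p], z = algebraMap ℚ_[p] K s → False := by
    intro s hs
    rw [hN, hs, norm_algebraMap_of_quadratic hK] at h
    rw [hT, hs, trace_algebraMap_of_quadratic hK, mul_pow] at hcon
    have h2 : ValGE 0 ((2 : ℚ_[p]) ^ 2) := by
      have : ValGE 0 (1 + 1 : ℚ_[p]) := valEq_one.valGE.add valEq_one.valGE
      rw [one_add_one_eq_two] at this
      exact this.sq
    exact hcon (by simpa using h2.mul h)
  rcases mul_eq_zero.1 hfac with h0 | h0
  · exact key _ (sub_eq_zero.1 h0)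
  · exact key _ (sub_eq_zero.1 h0)

/-- A small element of `ℤ_p` is the value at a multiple of `z` of `N (1 + ·) - 1` when the norm
of `z` is smaller than its trace. -/
lemma exists_norm_one_add_mul (hK : Module.finrank ℚ_[p] K = 2) {z : K} {t n : ℤ} {c : ℚ_[p]}
    (hT : ValEq t (Algebra.trace ℚ_[p] K z)) (hN : ValGE n (Algebra.norm ℚ_[p] z)) (htn : t < n)
    (hc : ValGE t c) :
    ∃ w : K, Algebra.norm ℚ_[p] (1 + w) = 1 + c ∧ ValGE n (Algebra.norm ℚ_[p] w) := by
  set T := Algebra.trace ℚ_[p] K z with hT'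
  set N := Algebra.norm ℚ_[p] z with hN'
  have hT0 := hT.ne_zero
  obtain ⟨y, hy0, hy⟩ := exists_quadratic_root (α := N / T) (c := c / T)
    ((hN.div hT).mono (by omega)) ((hc.div hT).mono (by omega))
  refine ⟨algebraMap ℚ_[p] K y * z, ?_, ?_⟩
  · have := norm_add_mul_of_quadratic hK 1 y z
    rw [map_one] at this
    rw [this, ← hT', ← hN']
    field_simp at hy
    linear_combination hy
  · rw [map_mul, norm_algebraMap_of_quadratic hK]
    simpa using hy0.sq.mul hN

lemma valGE_norm_sub_one (hK : Module.finrank ℚ_[p] K = 2) {w : K}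
    (hw : ValGE 0 (Algebra.norm ℚ_[p] w)) : ValGE 0 (Algebra.norm ℚ_[p] (w - 1)) := by
  have hT : ValGE 0 (Algebra.trace ℚ_[p] K w) := (ValGE.trace_sq hK hw).of_sq (by omega)
  have h := norm_add_mul_of_quadratic hK (-1) 1 w
  rw [map_neg, map_one, one_mul, neg_add_eq_sub] at h
  convert (hw.sub hT).add valEq_one.valGE using 1
  linear_combination h

lemma norm_ne_zero_of_quadratic (hK : Module.finrank ℚ_[p] K = 2) {z : K} (hz : z ≠ 0) :
    Algebra.norm ℚ_[p] z ≠ 0 := by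
  have : Module.Finite ℚ_[p] K := Module.finite_of_finrank_pos (by omega)
  exact Algebra.norm_ne_zero_iff.2 hz

variable (D : PadicValData p K)

lemma PadicValData.v_one : D.v 1 = 0 := by
  have := D.v_mul 1 1 one_ne_zero one_ne_zero
  rw [mul_one] at this
  omega

lemma PadicValData.v_neg {x : K} (hx : x ≠ 0) : D.v (-x) = D.v x := by
  have h1 := D.v_mul (-1) (-1) (by simp) (by simp)
  have h2 := D.v_mul (-1) x (by simp) hx
  rw [neg_one_mul] at h2
  rw [neg_mul_neg, mul_one, D.v_one] at h1
  omega

lemma PadicValData.v_inv {x : K} (hx : x ≠ 0) : D.v x⁻¹ = -D.v x := by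
  have h1 := D.v_mul x x⁻¹ hx (inv_ne_zero hx)
  rw [mul_inv_cancel₀ hx, D.v_one] at h1
  omega

lemma PadicValData.v_nonneg_of_norm_eq_one (hK : Module.finrank ℚ_[p] K = 2) {y : K} (hy : y ≠ 0)
    (hN : Algebra.norm ℚ_[p] y = 1) : 0 ≤ D.v y := by
  by_contra! hlt
  set T := Algebra.trace ℚ_[p] K y with hT'
  have hT : ValGE 0 T := ValGE.of_sq (ValGE.trace_sq hK (hN ▸ valEq_one.valGE)) (by omega)
  have hsq := sq_eq_of_quadratic hK y
  rw [hN, map_one, ← hT'] at hsq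
  have hvsq : D.v (y ^ 2) = 2 * D.v y := by rw [sq, D.v_mul y y hy hy]; ring
  by_cases hT0 : T = 0
  · rw [hT0, map_zero, zero_mul, zero_sub] at hsq
    rw [hsq, D.v_neg one_ne_zero, D.v_one] at hvsq
    omega
  have hT0' : algebraMap ℚ_[p] K T ≠ 0 := by simpa using hT0
  have hvT := D.v_compat T hT0
  have hTval := (valEq_valuation hT0).le_of_valGE hT
  have hnn : 0 ≤ (D.e : ℤ) * T.valuation := by positivity
  have hvTy := D.v_mul _ _ hT0' hy
  have hadd := D.v_add (algebraMap ℚ_[p] K T * y) (-1) (mul_ne_zero hT0' hy) (by simp)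
    (by rw [← sub_eq_add_neg, ← hsq]; exact pow_ne_zero 2 hy)
  rw [← sub_eq_add_neg, ← hsq, hvsq, D.v_neg one_ne_zero, D.v_one, hvTy, hvT] at hadd
  omega

lemma PadicValData.two_mul_v (hK : Module.finrank ℚ_[p] K = 2) {x : K} (hx : x ≠ 0) :
    2 * D.v x = D.e * (Algebra.norm ℚ_[p] x).valuation := by
  have hN0 := norm_ne_zero_of_quadratic hK hx
  have hN0' : algebraMap ℚ_[p] K (Algebra.norm ℚ_[p] x) ≠ 0 := by simpa using hN0
  set y := x * x * (algebraMap ℚ_[p] K (Algebra.norm ℚ_[p] x))⁻¹ with hy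
  have hy0 : y ≠ 0 := mul_ne_zero (mul_ne_zero hx hx) (inv_ne_zero hN0')
  have hNy : Algebra.norm ℚ_[p] y = 1 := by
    rw [hy, ← map_inv₀, map_mul, map_mul, norm_algebraMap_of_quadratic hK]
    field_simp
  have h1 := D.v_nonneg_of_norm_eq_one hK hy0 hNy
  have h2 := D.v_nonneg_of_norm_eq_one hK (inv_ne_zero hy0) (by
    have h := congrArg (Algebra.norm ℚ_[p]) (mul_inv_cancel₀ hy0)
    rwa [map_mul, hNy, one_mul, map_one] at h)
  rw [D.v_inv hy0] at h2
  rw [hy, D.v_mul _ _ (mul_ne_zero hx hx) (inv_ne_zero hN0'), D.v_mul _ _ hx hx, D.v_inv hN0',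
    D.v_compat _ hN0] at h1 h2
  omega

lemma PadicValData.valEq_norm (hK : Module.finrank ℚ_[p] K = 2) {f : ℕ} (hf : D.e * f = 2)
    {x : K} (hx : x ≠ 0) : ValEq (f * D.v x) (Algebra.norm ℚ_[p] x) := by
  have h := D.two_mul_v hK hx
  have hval : (Algebra.norm ℚ_[p] x).valuation = f * D.v x := by
    have he : (D.e : ℤ) ≠ 0 := by
      intro h0
      rw [Nat.cast_eq_zero] at h0
      simp [h0] at hf
    apply mul_left_cancel₀ he
    have hf' : (D.e : ℤ) * f = 2 := by exact_mod_cast hf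
    rw [← h, ← mul_assoc, hf']
  exact hval ▸ valEq_valuation (norm_ne_zero_of_quadratic hK hx)

lemma isTrivialOnK_iff (hK : Module.finrank ℚ_[p] K = 2) {f : ℕ} (hf : D.e * f = 2)
    (κ : Kˣ →* ℂˣ) (i : ℕ) :
    IsTrivialOnK D κ i ↔ ∀ u : Kˣ, ValEq 0 (Algebra.norm ℚ_[p] (u : K)) →
      ValGE (f * i) (Algebra.norm ℚ_[p] ((u : K) - 1)) → κ u = 1 := by
  have hf0 : (0 : ℤ) < f := by
    rcases Nat.eq_zero_or_pos f with h | h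
    · simp [h] at hf
    · exact_mod_cast h
  refine forall_congr' fun u ↦ imp_congr ?_ (imp_congr_left ?_)
  · have h := D.valEq_norm hK hf u.ne_zero
    constructor
    · intro h0
      rwa [h0, mul_zero] at h
    · intro h0
      simpa [Nat.cast_pos.1 hf0 |>.ne'] using (h.unique h0).symm
  · by_cases h1 : (u : K) - 1 = 0
    · have : Module.Finite ℚ_[p] K := Module.finite_of_finrank_pos (by omega)
      simp [h1, Algebra.norm_zero, valGE_zero]
    · have h := D.valEq_norm hK hf h1
      simp only [h1, false_or]
      constructor
      · intro h0
        exact h.valGE.mono (by gcongr)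
      · intro h0
        exact le_of_mul_le_mul_left (h.le_of_valGE h0) hf0

end NormValuation

section Ramified

variable {p : ℕ} [Fact p.Prime] {K : Type*} [Field K] [Algebra ℚ_[p] K]

lemma exists_valEq_discr {θ : K} (hθ : ValEq 1 (Algebra.norm ℚ_[p] θ)) :
    ∃ d, ValEq d (Algebra.trace ℚ_[p] K θ ^ 2 - 4 * Algebra.norm ℚ_[p] θ) := by
  apply exists_valEq
  intro h0
  obtain ⟨k, hk⟩ := exists_valEq (two_ne_zero : (2 : ℚ_[p]) ≠ 0)
  have h4 := hk.sq.mul hθ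
  have hsq : (2 : ℚ_[p]) ^ 2 * Algebra.norm ℚ_[p] θ = Algebra.trace ℚ_[p] K θ ^ 2 := by
    linear_combination -h0
  rw [hsq] at h4
  obtain ⟨j, hj⟩ := exists_valEq (pow_ne_zero_iff two_ne_zero |>.1 h4.ne_zero)
  have := hj.sq.unique h4
  omega

/-- Either the trace of the uniformizer `θ` or the number `2` determines the discriminant. -/
lemma valEq_discr_cases (hK : Module.finrank ℚ_[p] K = 2) {θ : K}
    (hθ : ValEq 1 (Algebra.norm ℚ_[p] θ)) {d : ℤ}
    (hd : ValEq d (Algebra.trace ℚ_[p] K θ ^ 2 - 4 * Algebra.norm ℚ_[p] θ)) :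
    (∃ k, 1 ≤ k ∧ d = 2 * k ∧ ValEq k (Algebra.trace ℚ_[p] K θ) ∧ ValGE k (2 : ℚ_[p])) ∨
    (∃ k, 0 ≤ k ∧ d = 2 * k + 1 ∧ ValEq k (2 : ℚ_[p]) ∧
      ValGE (k + 1) (Algebra.trace ℚ_[p] K θ)) := by
  have hT1 : ValGE 1 (Algebra.trace ℚ_[p] K θ) := (ValGE.trace_sq hK hθ.valGE).of_sq (by omega)
  set T := Algebra.trace ℚ_[p] K θ
  set M := Algebra.norm ℚ_[p] θ
  obtain ⟨k, hk⟩ := exists_valEq (two_ne_zero : (2 : ℚ_[p]) ≠ 0)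
  have hk0 : 0 ≤ k := by
    have h : ValGE 0 (1 + 1 : ℚ_[p]) := valEq_one.valGE.add valEq_one.valGE
    rw [one_add_one_eq_two] at h
    exact hk.le_of_valGE h
  have h4 : ValEq (2 * k + 1) (-(4 * M)) := by
    have := (hk.sq.mul hθ).neg
    norm_num at this ⊢
    exact this
  by_cases hT : ValGE (k + 1) T
  · refine Or.inr ⟨k, hk0, ?_, hk, hT⟩
    have := h4.add (hT.sq.mono (by omega))
    rw [neg_add_eq_sub] at this
    exact this.unique hd
  · have hT0 : T ≠ 0 := fun h ↦ hT (h ▸ valGE_zero _)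
    obtain ⟨j, hj⟩ := exists_valEq hT0
    have hjk : j ≤ k := by
      by_contra! hlt
      exact hT (hj.valGE.mono (by omega))
    refine Or.inl ⟨j, hj.le_of_valGE hT1, ?_, hj, hk.valGE.mono hjk⟩
    have := hj.sq.add (h4.valGE.mono (by omega))
    rw [← sub_eq_add_neg] at this
    exact this.unique hd

lemma exists_coordinates_of_ramified (hK : Module.finrank ℚ_[p] K = 2) {θ : K}
    (hθ : ValEq 1 (Algebra.norm ℚ_[p] θ)) {n : ℤ} {z : K}
    (hz : ValGE n (Algebra.norm ℚ_[p] z)) :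
    ∃ a b, z = algebraMap ℚ_[p] K a + algebraMap ℚ_[p] K b * θ ∧
      ValGE n (a ^ 2) ∧ ValGE (n - 1) (b ^ 2) := by
  have hT : ValGE 1 (Algebra.trace ℚ_[p] K θ) := (ValGE.trace_sq hK hθ.valGE).of_sq (by omega)
  have hgen : ∀ a, algebraMap ℚ_[p] K a ≠ θ := by
    rintro a rfl
    rw [norm_algebraMap_of_quadratic hK] at hθ
    obtain ⟨k, hk⟩ := exists_valEq (pow_ne_zero_iff two_ne_zero |>.1 hθ.ne_zero)
    have := hk.sq.unique hθ
    omega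
  obtain ⟨a, b, rfl⟩ := exists_eq_add_mul_of_quadratic hK hgen z
  refine ⟨a, b, rfl, ?_⟩
  rw [norm_add_mul_of_quadratic hK] at hz
  set T := Algebra.trace ℚ_[p] K θ
  set M := Algebra.norm ℚ_[p] θ
  by_cases ha : a = 0
  · subst ha
    by_cases hb : b = 0
    · subst hb
      simp [valGE_zero]
    obtain ⟨j, hj⟩ := exists_valEq hb
    have := (hj.sq.mul hθ).le_of_valGE (by simpa using hz)
    exact ⟨by simpa using valGE_zero _, hj.sq.valGE.mono (by omega)⟩
  by_cases hb : b = 0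
  · subst hb
    exact ⟨by simpa using hz, by simpa using valGE_zero _⟩
  obtain ⟨i, hi⟩ := exists_valEq ha
  obtain ⟨j, hj⟩ := exists_valEq hb
  have hmid := (hi.valGE.mul hj.valGE).mul hT
  have hlast := hj.sq.mul hθ
  rcases le_or_gt i j with hij | hij
  · have h1 := hi.sq.add ((hmid.mono (m := 2 * i + 1) (by omega)).add
      (hlast.valGE.mono (by omega)))
    rw [← add_assoc] at h1
    have := h1.le_of_valGE hz
    exact ⟨hi.sq.valGE.mono this, hj.sq.valGE.mono (by omega)⟩
  · have h1 := hlast.add ((hi.sq.valGE.mono (m := 2 * j + 1 + 1) (by omega)).add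
      (hmid.mono (by omega)))
    rw [add_comm (b ^ 2 * M)] at h1
    have := h1.le_of_valGE hz
    exact ⟨hi.sq.valGE.mono (by omega), hj.sq.valGE.mono (by omega)⟩

variable (hK : Module.finrank ℚ_[p] K = 2) {θ : K} (hθ : ValEq 1 (Algebra.norm ℚ_[p] θ)) {d : ℤ}
  (hd : ValEq d (Algebra.trace ℚ_[p] K θ ^ 2 - 4 * Algebra.norm ℚ_[p] θ))

include hK hθ hd

lemma valGE_trace_of_ramified {m n : ℤ} {z : K} (hz : ValGE n (Algebra.norm ℚ_[p] z))
    (hm : 2 * m ≤ n + d) : ValGE m (Algebra.trace ℚ_[p] K z) := by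
  obtain ⟨a, b, rfl, ha, hb⟩ := exists_coordinates_of_ramified hK hθ hz
  rw [trace_add_mul_of_quadratic hK]
  apply ValGE.add
  · apply ValGE.of_sq (m := d - 1 + n) _ (by omega)
    rw [mul_pow]
    refine ValGE.mul ?_ ha
    rcases valEq_discr_cases hK hθ hd with ⟨k, -, rfl, -, hk⟩ | ⟨k, -, rfl, hk, -⟩
    · exact hk.sq.mono (by omega)
    · exact hk.sq.valGE.mono (by omega)
  · apply ValGE.of_sq (m := n - 1 + d) _ (by omega)
    rw [mul_pow]
    refine ValGE.mul hb ?_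
    rcases valEq_discr_cases hK hθ hd with ⟨k, -, rfl, hk, -⟩ | ⟨k, -, rfl, -, hk⟩
    · exact hk.sq.valGE
    · exact hk.sq.mono (by omega)

lemma valGE_norm_one_add_of_ramified {m n : ℤ} {z : K} (hz : ValGE n (Algebra.norm ℚ_[p] z))
    (hmn : m ≤ n) (hm : 2 * m ≤ n + d) : ValGE m (Algebra.norm ℚ_[p] (1 + z) - 1) := by
  rw [norm_one_add_of_quadratic hK, add_assoc, add_sub_cancel_left]
  exact (valGE_trace_of_ramified hK hθ hd hz hm).add (hz.mono hmn)

lemma exists_norm_eq_of_ramified {j : ℤ} (hj : 0 ≤ j) {c : ℚ_[p]} (hc : ValGE (d + j) c) :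
    ∃ w : K, Algebra.norm ℚ_[p] (1 + w) = 1 + c ∧
      ValGE (d + 2 * j + 1) (Algebra.norm ℚ_[p] w) := by
  rcases valEq_discr_cases hK hθ hd with ⟨k, hk1, hdk, hk, -⟩ | ⟨k, hk0, hdk, hk, -⟩
  · have ha := valEq_prime_zpow p (j + k)
    refine exists_norm_one_add_mul hK
      (z := algebraMap ℚ_[p] K 0 + algebraMap ℚ_[p] K ((p : ℚ_[p]) ^ (j + k)) * θ)
      (t := d + j) ?_ ?_ (by omega) hc
    · rw [trace_add_mul_of_quadratic hK, mul_zero, zero_add,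
        show d + j = j + k + k by omega]
      exact ha.mul hk
    · rw [norm_add_mul_of_quadratic hK]
      have := (ha.sq.mul hθ).valGE
      simpa using this.mono (by omega)
  · have ha := valEq_prime_zpow p (j + k + 1)
    refine exists_norm_one_add_mul hK
      (z := algebraMap ℚ_[p] K ((p : ℚ_[p]) ^ (j + k + 1)))
      (t := d + j) ?_ ?_ (by omega) hc
    · rw [trace_algebraMap_of_quadratic hK, show d + j = k + (j + k + 1) by omega]
      exact hk.mul ha
    · rw [norm_algebraMap_of_quadratic hK]
      exact ha.sq.valGE.mono (by omega)

lemma exists_norm_eq_norm_of_ramified {i : ℕ} (hi : i ≤ d) {w : K}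
    (hw : ValEq 0 (Algebra.norm ℚ_[p] w)) (hwi : ValGE i (Algebra.norm ℚ_[p] w - 1)) :
    ∃ z : K, Algebra.norm ℚ_[p] (1 + z) = Algebra.norm ℚ_[p] w ∧
      ValGE i (Algebra.norm ℚ_[p] z) := by
  rcases hi.eq_or_lt with hid | hid
  · obtain ⟨z, hz, hz'⟩ := exists_norm_eq_of_ramified hK hθ hd le_rfl
      (hwi.mono (m := d + 0) (by omega))
    exact ⟨z, by rw [hz]; ring, hz'.mono (by omega)⟩
  refine ⟨w - 1, by rw [add_sub_cancel], ?_⟩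
  have hNw : Algebra.norm ℚ_[p] w =
      1 + Algebra.trace ℚ_[p] K (w - 1) + Algebra.norm ℚ_[p] (w - 1) := by
    rw [← norm_one_add_of_quadratic hK, add_sub_cancel]
  suffices ∀ j : ℕ, j ≤ i → ValGE j (Algebra.norm ℚ_[p] (w - 1)) from this i le_rfl
  intro j
  induction j with
  | zero =>
    intro _
    exact valGE_norm_sub_one hK hw.valGE
  | succ j ih =>
    intro hji
    have hT := valGE_trace_of_ramified hK hθ hd (m := (j + 1 : ℕ)) (ih (by omega))
      (by push_cast; omega)
    have h := (hwi.mono (m := (j + 1 : ℕ)) (by omega)).sub hT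
    convert h using 1
    rw [hNw]
    ring

lemma exists_norm_eq_of_forall_ramified
    (h : ∀ u : ℚ_[p], ValEq 0 u → ValGE (d - 1) (u - 1) → ∃ z : K, Algebra.norm ℚ_[p] z = u)
    {x : ℚ_[p]} (hx : x ≠ 0) : ∃ z : K, Algebra.norm ℚ_[p] z = x := by
  have hreduce (h0 : ∀ u : ℚ_[p], ValEq 0 u → ∃ z : K, Algebra.norm ℚ_[p] z = u) :
      ∃ z : K, Algebra.norm ℚ_[p] z = x := by
    obtain ⟨n, hn⟩ := exists_valEq hx
    have hz : ∃ z : K, ValEq n (Algebra.norm ℚ_[p] z) := by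
      obtain ⟨k, hk | hk⟩ := Int.even_or_odd' n
      · refine ⟨algebraMap ℚ_[p] K ((p : ℚ_[p]) ^ k), ?_⟩
        rw [norm_algebraMap_of_quadratic hK, hk]
        exact (valEq_prime_zpow p k).sq
      · refine ⟨algebraMap ℚ_[p] K ((p : ℚ_[p]) ^ k) * θ, ?_⟩
        rw [map_mul, norm_algebraMap_of_quadratic hK, hk]
        exact (valEq_prime_zpow p k).sq.mul hθ
    obtain ⟨z, hz⟩ := hz
    obtain ⟨w, hw⟩ := h0 (x / Algebra.norm ℚ_[p] z) (sub_self n ▸ hn.div hz)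
    exact ⟨w * z, by rw [map_mul, hw, div_mul_cancel₀ _ hz.ne_zero]⟩
  have hunit {u : ℚ_[p]} (hu : ValEq 0 u) : ValGE 0 (u - 1) := hu.valGE.sub valEq_one.valGE
  by_cases hd1 : d ≤ 1
  · exact hreduce fun u hu ↦ h u hu ((hunit hu).mono (by omega))
  have hp : p = 2 := by
    by_contra hp
    have h2 := valEq_two_of_ne_two hp
    rcases valEq_discr_cases hK hθ hd with ⟨k, hk1, -, -, hk⟩ | ⟨k, -, hdk, hk, -⟩
    · have := h2.le_of_valGE hk
      omega
    · have := h2.unique hk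
      omega
  subst hp
  rcases valEq_discr_cases hK hθ hd with ⟨k, hk1, hdk, -, hk⟩ | ⟨k, -, hdk, hk, hT⟩
  · have := valEq_two_of_two.le_of_valGE hk
    exact hreduce fun u hu ↦ h u hu (hu.sub_one_of_two.mono (by omega))
  obtain rfl := hk.unique valEq_two_of_two
  exfalso
  have h4 : ValEq 2 (4 : ℚ_[2]) := by
    have := valEq_two_of_two.sq
    norm_num at this
    exact this
  have h5 : ValEq 0 (1 + 4 : ℚ_[2]) := valEq_one.add (h4.valGE.mono (by omega))
  have h5' : ValGE 2 ((1 + 4 : ℚ_[2]) - 1) := by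
    rw [add_sub_cancel_left]
    exact h4.valGE
  obtain ⟨w, hw⟩ := h _ h5 (h5'.mono (by omega))
  obtain ⟨z, hz, hzN⟩ := exists_norm_eq_norm_of_ramified hK hθ hd (i := 2) (by omega)
    (hw ▸ h5) (hw ▸ h5')
  obtain ⟨a, b, rfl, ha, hb⟩ := exists_coordinates_of_ramified hK hθ hzN
  replace ha : ValGE 1 a := ha.of_sq (by omega)
  replace hb : ValGE 1 b := hb.of_sq (by omega)
  rw [hw, norm_one_add_of_quadratic hK, trace_add_mul_of_quadratic hK,
    norm_add_mul_of_quadratic hK] at hz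
  have hsum : ValGE 3 (a * (a + 2)) := by
    rcases ha.valEq_or with ha' | ha'
    · have hu : ValEq 0 (-(a / 2)) := (sub_self (1 : ℤ) ▸ ha'.div valEq_two_of_two).neg
      have h6 := ha.mul (valEq_two_of_two.valGE.mul hu.sub_one_of_two)
      convert h6.neg.mono _ using 1
      · ring
      · norm_num
    · exact (ha'.mul (ha.add valEq_two_of_two.valGE)).mono (by norm_num)
  have hbT : ValGE 3 (b * (1 + a) * Algebra.trace ℚ_[2] K θ) :=
    ((hb.mul (valEq_one.valGE.add (ha.mono (by omega)))).mul hT).mono (by norm_num)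
  have hbM : ValGE 3 (b ^ 2 * Algebra.norm ℚ_[2] θ) := (hb.sq.mul hθ.valGE).mono (by norm_num)
  have h7 := (hsum.add hbT).add hbM
  have : (4 : ℤ) ≤ 3 := by
    have := h4.le_of_valGE (m := 3) (by convert h7 using 1; linear_combination -hz)
    omega
  omega

end Ramified

section Unramified

variable {p : ℕ} [Fact p.Prime] {K : Type*} [Field K] [Algebra ℚ_[p] K]

lemma exists_valGE_one_sq_add_mul_sq_sub (hp : p ≠ 2) {m u : ℚ_[p]} (hm : ValEq 0 m)
    (hu : ValGE 0 u) : ∃ a b : ℚ_[p], ValGE 1 (a ^ 2 + b ^ 2 * m - u) := by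
  rw [valEq_zero_iff] at hm
  rw [valGE_zero_iff] at hu
  let M : ℤ_[p] := ⟨m, hm.le⟩
  let U : ℤ_[p] := ⟨u, hu⟩
  have hM : PadicInt.toZMod M ≠ 0 := by
    intro h
    rw [← RingHom.mem_ker, PadicInt.ker_toZMod, IsLocalRing.mem_maximalIdeal, mem_nonunits_iff,
      PadicInt.isUnit_iff] at h
    exact h hm
  obtain ⟨a, b, hab⟩ := FiniteField.exists_root_sum_quadratic
    (f := .X ^ 2 - .C (PadicInt.toZMod U)) (g := .C (PadicInt.toZMod M) * .X ^ 2)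
    (Polynomial.degree_X_pow_sub_C two_pos _) (Polynomial.degree_C_mul_X_pow 2 hM)
    (by rw [ZMod.card]; exact (Fact.out : p.Prime).mod_two_eq_one_iff_ne_two.2 hp)
  obtain ⟨A, rfl⟩ := ZMod.ringHom_surjective (PadicInt.toZMod (p := p)) a
  obtain ⟨B, rfl⟩ := ZMod.ringHom_surjective (PadicInt.toZMod (p := p)) b
  refine ⟨A, B, ?_⟩
  have hker : A ^ 2 + B ^ 2 * M - U ∈ RingHom.ker (PadicInt.toZMod (p := p)) := by
    simp only [RingHom.mem_ker, map_sub, map_add, map_mul, map_pow]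
    simp at hab
    linear_combination hab
  rw [PadicInt.ker_toZMod, PadicInt.maximalIdeal_eq_span_p] at hker
  have := (PadicInt.norm_le_pow_iff_mem_span_pow _ 1).2 (by simpa using hker)
  exact_mod_cast this

variable (hK : Module.finrank ℚ_[p] K = 2)
  (hpar : ∀ x : K, x ≠ 0 → ∃ n : ℤ, ValEq (2 * n) (Algebra.norm ℚ_[p] x))

include hK hpar

lemma exists_trace_zero_of_unramified :
    ∃ δ : K, Algebra.trace ℚ_[p] K δ = 0 ∧ ValEq 0 (Algebra.norm ℚ_[p] δ) := by
  obtain ⟨x, hx⟩ : ∃ x : K, ∀ a, algebraMap ℚ_[p] K a ≠ x := by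
    by_contra! h
    have := finrank_le_one (R := ℚ_[p]) (1 : K) fun x ↦ by
      obtain ⟨a, rfl⟩ := h x
      exact ⟨a, by rw [Algebra.smul_def, mul_one]⟩
    omega
  set c := -(Algebra.trace ℚ_[p] K x / 2) with hc
  have hy : algebraMap ℚ_[p] K c + x ≠ 0 := by
    intro h
    apply hx (-c)
    rw [map_neg]
    linear_combination -h
  obtain ⟨n, hn⟩ := hpar _ hy
  refine ⟨algebraMap ℚ_[p] K ((p : ℚ_[p]) ^ (-n)) * (algebraMap ℚ_[p] K c + x), ?_, ?_⟩
  · rw [← Algebra.smul_def, map_smul, map_add, trace_algebraMap_of_quadratic hK, hc, mul_neg,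
      mul_div_cancel₀ _ two_ne_zero, neg_add_cancel, smul_zero]
  · rw [map_mul, norm_algebraMap_of_quadratic hK]
    have := (valEq_prime_zpow p (-n)).sq.mul hn
    rwa [show 2 * -n + 2 * n = 0 by omega] at this

lemma exists_trace_unit_of_unramified :
    ∃ z : K, ValEq 0 (Algebra.trace ℚ_[p] K z) ∧ ValGE 0 (Algebra.norm ℚ_[p] z) := by
  by_cases hp : p = 2
  · subst hp
    obtain ⟨δ, hT, hN⟩ := exists_trace_zero_of_unramified hK hpar
    have hδ : 1 + δ ≠ 0 := by
      intro h
      have h1 := trace_algebraMap_of_quadratic (K := K) hK (-1)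
      rw [map_neg, map_one, ← eq_neg_of_add_eq_zero_right h, hT] at h1
      norm_num at h1
    obtain ⟨n, hn⟩ := hpar _ hδ
    have h1 : ValGE 1 (1 + Algebra.norm ℚ_[2] δ) := by
      convert hN.neg.sub_one_of_two.neg using 1
      ring
    have hn' := hn
    rw [norm_one_add_of_quadratic hK, hT, add_zero] at hn'
    have := hn'.le_of_valGE h1
    have h2 := valEq_two_of_two.inv
    refine ⟨algebraMap ℚ_[2] K 2⁻¹ * (1 + δ), ?_, ?_⟩
    · have := trace_algebraMap_of_quadratic (K := K) hK (1 : ℚ_[2])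
      rw [map_one] at this
      rw [← Algebra.smul_def, map_smul, map_add, hT, this]
      simpa using valEq_one
    · rw [map_mul, norm_algebraMap_of_quadratic hK]
      exact (h2.sq.mul hn).valGE.mono (by omega)
  · refine ⟨algebraMap ℚ_[p] K 1, ?_, ?_⟩
    · rw [trace_algebraMap_of_quadratic hK, mul_one]
      exact valEq_two_of_ne_two hp
    · rw [norm_algebraMap_of_quadratic hK, one_pow]
      exact valEq_one.valGE

lemma exists_norm_eq_of_unramified_of_pos {i : ℤ} (hi : 0 < i) {u : ℚ_[p]}
    (hu : ValGE i (u - 1)) :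
    ∃ w : K, Algebra.norm ℚ_[p] w = u ∧ ValGE (2 * i) (Algebra.norm ℚ_[p] (w - 1)) := by
  obtain ⟨z, hT, hN⟩ := exists_trace_unit_of_unramified hK hpar
  obtain ⟨w, hw, hw'⟩ := exists_norm_one_add_mul hK
    (z := algebraMap ℚ_[p] K ((p : ℚ_[p]) ^ i) * z) (t := i) (n := 2 * i)
    (by
      have := (valEq_prime_zpow p i).mul hT
      rw [add_zero] at this
      rwa [← Algebra.smul_def, map_smul, smul_eq_mul])
    (by
      rw [map_mul, norm_algebraMap_of_quadratic hK]
      exact add_zero (2 * i) ▸ (valEq_prime_zpow p i).sq.valGE.mul hN)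
    (by omega) hu
  exact ⟨1 + w, by rw [hw]; ring, by rwa [add_sub_cancel_left]⟩

lemma exists_norm_eq_of_unramified {i : ℕ} {u : ℚ_[p]} (hu : ValEq 0 u)
    (hui : ValGE i (u - 1)) :
    ∃ w : K, Algebra.norm ℚ_[p] w = u ∧ ValGE (2 * i) (Algebra.norm ℚ_[p] (w - 1)) := by
  rcases Nat.eq_zero_or_pos i with rfl | hi
  · suffices ∃ w : K, Algebra.norm ℚ_[p] w = u by
      obtain ⟨w, hw⟩ := this
      exact ⟨w, hw, by simpa using valGE_norm_sub_one hK (hw ▸ hu.valGE)⟩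
    obtain ⟨w, hw⟩ : ∃ w : K, ValGE 1 (Algebra.norm ℚ_[p] w - u) := by
      by_cases hp : p = 2
      · subst hp
        exact ⟨1, by simpa using hu.sub_one_of_two.neg⟩
      · obtain ⟨δ, hT, hN⟩ := exists_trace_zero_of_unramified hK hpar
        obtain ⟨a, b, hab⟩ := exists_valGE_one_sq_add_mul_sq_sub hp hN hu.valGE
        refine ⟨algebraMap ℚ_[p] K a + algebraMap ℚ_[p] K b * δ, ?_⟩
        rwa [norm_add_mul_of_quadratic hK, hT, mul_zero, add_zero]
    have hwu : ValEq 0 (Algebra.norm ℚ_[p] w) := by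
      simpa using hu.add hw
    have hdiv : ValGE 1 (u / Algebra.norm ℚ_[p] w - 1) := by
      have := hw.neg.div hwu
      rwa [neg_sub, sub_div, div_self hwu.ne_zero] at this
    obtain ⟨w', hw', -⟩ := exists_norm_eq_of_unramified_of_pos hK hpar one_pos hdiv
    exact ⟨w' * w, by rw [map_mul, hw', div_mul_cancel₀ _ hwu.ne_zero]⟩
  · exact exists_norm_eq_of_unramified_of_pos hK hpar (by omega) hui

omit hpar in
lemma valGE_norm_one_add {i : ℕ} {z : K} (hz : ValGE (2 * i) (Algebra.norm ℚ_[p] z)) :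
    ValGE i (Algebra.norm ℚ_[p] (1 + z) - 1) := by
  rw [norm_one_add_of_quadratic hK, add_assoc, add_sub_cancel_left]
  exact ((ValGE.trace_sq hK hz).of_sq (by omega)).add (hz.mono (by omega))

end Unramified

section Conductor

variable {p : ℕ} [Fact p.Prime] {K : Type*} [Field K] [Algebra ℚ_[p] K]

lemma isTrivialOnQ_iff (χ : (ℚ_[p])ˣ →* ℂˣ) (i : ℕ) :
    IsTrivialOnQ p χ i ↔
      ∀ u : (ℚ_[p])ˣ, ValEq 0 (u : ℚ_[p]) → ValGE i ((u : ℚ_[p]) - 1) → χ u = 1 := by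
  simp only [IsTrivialOnQ, valEq_zero_iff, ValGE]

lemma IsTrivialOnQ.mono {χ : (ℚ_[p])ˣ →* ℂˣ} {i j : ℕ} (h : IsTrivialOnQ p χ i) (hij : i ≤ j) :
    IsTrivialOnQ p χ j := by
  rw [isTrivialOnQ_iff] at *
  exact fun u hu hu' ↦ h u hu (hu'.mono (by omega))

lemma IsTrivialOnQ.mul {χ ψ : (ℚ_[p])ˣ →* ℂˣ} {i : ℕ} (h : IsTrivialOnQ p χ i)
    (h' : IsTrivialOnQ p ψ i) : IsTrivialOnQ p (χ * ψ) i :=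
  fun u hu hu' ↦ by rw [MonoidHom.mul_apply, h u hu hu', h' u hu hu', one_mul]

lemma condQ_le_iff {χ : (ℚ_[p])ˣ →* ℂˣ} (h : ∃ i, IsTrivialOnQ p χ i) (n : ℕ) :
    condQ p χ ≤ n ↔ IsTrivialOnQ p χ n :=
  have h0 : IsTrivialOnQ p χ (condQ p χ) := Nat.sInf_mem h
  ⟨h0.mono, fun hn ↦ Nat.sInf_le hn⟩

lemma IsTrivialOnK.mono {D : PadicValData p K} {κ : Kˣ →* ℂˣ} {i j : ℕ}
    (h : IsTrivialOnK D κ i) (hij : i ≤ j) : IsTrivialOnK D κ j :=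
  fun u hu hu' ↦ h u hu (hu'.imp_right fun h' ↦ le_trans (by exact_mod_cast hij) h')

lemma condK_le_iff {D : PadicValData p K} {κ : Kˣ →* ℂˣ} (h : ∃ i, IsTrivialOnK D κ i) (n : ℕ) :
    condK D κ ≤ n ↔ IsTrivialOnK D κ n :=
  have h0 : IsTrivialOnK D κ (condK D κ) := Nat.sInf_mem h
  ⟨h0.mono, fun hn ↦ Nat.sInf_le hn⟩

lemma exists_unit_norm_eq (hK : Module.finrank ℚ_[p] K = 2) {z : K} {x : (ℚ_[p])ˣ}
    (hz : Algebra.norm ℚ_[p] z = x) :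
    ∃ y : Kˣ, (y : K) = z ∧ Units.map (Algebra.norm ℚ_[p] : K →* ℚ_[p]) y = x := by
  have : Module.Finite ℚ_[p] K := Module.finite_of_finrank_pos (by omega)
  have hz0 : z ≠ 0 := by
    rintro rfl
    rw [Algebra.norm_zero] at hz
    exact x.ne_zero hz.symm
  exact ⟨Units.mk0 z hz0, rfl, Units.ext hz⟩

lemma isTrivialOnK_comp_norm_iff_of_unramified (hK : Module.finrank ℚ_[p] K = 2)
    (D : PadicValData p K) (hf : D.e * 2 = 2) (χ : (ℚ_[p])ˣ →* ℂˣ) (i : ℕ) :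
    IsTrivialOnK D (χ.comp (Units.map (Algebra.norm ℚ_[p] : K →* ℚ_[p]))) i ↔
      IsTrivialOnQ p χ i := by
  rw [isTrivialOnK_iff D hK hf, isTrivialOnQ_iff]
  push_cast
  constructor
  · intro h u hu hui
    obtain ⟨w, hw, hwi⟩ := exists_norm_eq_of_unramified hK
      (fun x hx ↦ ⟨D.v x, by exact_mod_cast D.valEq_norm hK hf hx⟩) hu hui
    obtain ⟨y, rfl, hy⟩ := exists_unit_norm_eq hK hw
    rw [← hy]
    exact h y (hw ▸ hu) hwi
  · intro h u hu hui
    have := valGE_norm_one_add hK hui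
    rw [add_sub_cancel] at this
    exact h _ hu this

lemma isTrivialOnQ_or_of_forall_ker {χ ω : (ℚ_[p])ˣ →* ℂˣ} (hω : ω ^ 2 = 1) {i : ℕ}
    (h : ∀ u : (ℚ_[p])ˣ, ValEq 0 (u : ℚ_[p]) → ValGE i ((u : ℚ_[p]) - 1) → ω u = 1 → χ u = 1) :
    IsTrivialOnQ p χ i ∨ IsTrivialOnQ p (χ * ω) i := by
  simp only [isTrivialOnQ_iff]
  by_contra! hcon
  obtain ⟨⟨u, hu, hui, hχu⟩, ⟨v, hv, hvi, hχv⟩⟩ := hcon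
  have hmul {a b : (ℚ_[p])ˣ} (ha : ValEq 0 (a : ℚ_[p])) (hai : ValGE i ((a : ℚ_[p]) - 1))
      (hb : ValEq 0 (b : ℚ_[p])) (hbi : ValGE i ((b : ℚ_[p]) - 1)) (hab : ω (a * b) = 1) :
      χ (a * b) = 1 := by
    refine h _ (by simpa using ha.mul hb) ?_ hab
    have := (ha.valGE.mul hbi).add ((zero_add (i : ℤ)).symm ▸ hai)
    rw [zero_add] at this
    convert this using 1
    push_cast
    ring
  have hsgn {a : ℂˣ} (ha : a * a = 1) : a = 1 ∨ a = -1 := by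
    have h := congrArg Units.val ha
    rw [Units.val_mul, Units.val_one, mul_self_eq_one_iff] at h
    exact h.imp (fun h ↦ Units.ext h) (fun h ↦ Units.ext h)
  have hsq (a : (ℚ_[p])ˣ) : ω a = 1 ∨ ω a = -1 := by
    have h2 : ω a ^ 2 = 1 := by rw [← MonoidHom.pow_apply, hω, MonoidHom.one_apply]
    exact hsgn (by rw [← sq, h2])
  have hωu : ω u = -1 := (hsq u).resolve_left fun h1 ↦ hχu (h u hu hui h1)
  have hωv : ω v = -1 := (hsq v).resolve_left fun h1 ↦
    hχv (by rw [MonoidHom.mul_apply, h1, h v hv hvi h1, one_mul])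
  have h1 := hmul hu hui hu hui (by rw [map_mul, hωu, neg_mul_neg, one_mul])
  have h2 := hmul hu hui hv hvi (by rw [map_mul, hωu, hωv, neg_mul_neg, one_mul])
  rw [map_mul] at h1 h2
  have h3 : χ v = χ u := mul_left_cancel (h2.trans h1.symm)
  rw [MonoidHom.mul_apply, hωv, h3] at hχv
  rcases hsgn h1 with h5 | h5
  · exact hχu h5
  · exact hχv (by rw [h5, neg_mul_neg, one_mul])

section Ramified

variable (hK : Module.finrank ℚ_[p] K = 2) (D : PadicValData p K) (hf : D.e * 1 = 2) {θ : K}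
  (hθ : ValEq 1 (Algebra.norm ℚ_[p] θ)) {d : ℕ}
  (hd : ValEq d (Algebra.trace ℚ_[p] K θ ^ 2 - 4 * Algebra.norm ℚ_[p] θ))

include hK hf hθ hd

lemma isTrivialOnK_comp_norm_iff_of_ramified_of_le {χ ω : (ℚ_[p])ˣ →* ℂˣ} (hω : ω ^ 2 = 1)
    (hker : ∀ x : (ℚ_[p])ˣ, ω x = 1 ↔
      ∃ y : Kˣ, Units.map (Algebra.norm ℚ_[p] : K →* ℚ_[p]) y = x) {i : ℕ} (hi : i ≤ d) :
    IsTrivialOnK D (χ.comp (Units.map (Algebra.norm ℚ_[p] : K →* ℚ_[p]))) i ↔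
      IsTrivialOnQ p χ i ∨ IsTrivialOnQ p (χ * ω) i := by
  rw [isTrivialOnK_iff D hK hf]
  simp only [Nat.cast_one, one_mul]
  constructor
  · intro h
    refine isTrivialOnQ_or_of_forall_ker hω fun u hu hui hωu ↦ ?_
    obtain ⟨w, rfl⟩ := (hker u).1 hωu
    obtain ⟨z, hz, hzi⟩ := exists_norm_eq_norm_of_ramified hK hθ hd (by exact_mod_cast hi) hu hui
    obtain ⟨y, hy, hy'⟩ := exists_unit_norm_eq hK (hz.trans (Units.coe_map _ w).symm)
    rw [← hy']
    refine h y ?_ ?_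
    · rw [hy, hz]
      exact hu
    · rwa [hy, add_sub_cancel_left]
  · intro h u hu hui
    have hN := valGE_norm_one_add_of_ramified hK hθ hd (m := i) hui le_rfl (by omega)
    rw [add_sub_cancel] at hN
    simp only [isTrivialOnQ_iff] at h
    rcases h with h | h
    · exact h _ hu hN
    · have h1 := h (Units.map (Algebra.norm ℚ_[p] : K →* ℚ_[p]) u) hu hN
      rwa [MonoidHom.mul_apply, (hker _).2 ⟨u, rfl⟩, mul_one] at h1

lemma isTrivialOnK_comp_norm_iff_of_ramified_of_ge (χ : (ℚ_[p])ˣ →* ℂˣ) (k : ℕ) :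
    IsTrivialOnK D (χ.comp (Units.map (Algebra.norm ℚ_[p] : K →* ℚ_[p]))) (d + k) ↔
      IsTrivialOnQ p χ (d + k / 2) := by
  rw [isTrivialOnK_iff D hK hf, isTrivialOnQ_iff]
  simp only [Nat.cast_one, one_mul]
  constructor
  · intro h u hu hui
    obtain ⟨w, hw, hwi⟩ := exists_norm_eq_of_ramified hK hθ hd (j := (k / 2 : ℕ)) (by omega)
      (by exact_mod_cast hui)
    rw [add_sub_cancel] at hw
    obtain ⟨y, hy, hy'⟩ := exists_unit_norm_eq hK hw
    rw [← hy']
    refine h y ?_ ?_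
    · rwa [hy, hw]
    · rw [hy, add_sub_cancel_left]
      exact hwi.mono (by omega)
  · intro h u hu hui
    have hN := valGE_norm_one_add_of_ramified hK hθ hd (m := (d + k / 2 : ℕ)) hui
      (by omega) (by omega)
    rw [add_sub_cancel] at hN
    exact h _ hu hN

omit hf in
lemma condQ_eq_of_ramified {ω : (ℚ_[p])ˣ →* ℂˣ} (hω : ω ≠ 1)
    (hker : ∀ x : (ℚ_[p])ˣ, ω x = 1 ↔
      ∃ y : Kˣ, Units.map (Algebra.norm ℚ_[p] : K →* ℚ_[p]) y = x) : condQ p ω = d := by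
  have hd1 : (1 : ℤ) ≤ d := by
    rcases valEq_discr_cases hK hθ hd with ⟨k, hk, h, -⟩ | ⟨k, hk, h, -⟩ <;> omega
  have htriv : IsTrivialOnQ p ω d := by
    rw [isTrivialOnQ_iff]
    intro u hu hui
    obtain ⟨w, hw, -⟩ := exists_norm_eq_of_ramified hK hθ hd le_rfl ((add_zero (d : ℤ)).symm ▸ hui)
    rw [add_sub_cancel] at hw
    obtain ⟨y, -, hy⟩ := exists_unit_norm_eq hK hw
    exact (hker u).2 ⟨y, hy⟩
  refine le_antisymm ((condQ_le_iff ⟨d, htriv⟩ d).2 htriv) ?_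
  by_contra! hlt
  have h := (condQ_le_iff ⟨d, htriv⟩ (d - 1)).1 (by omega)
  rw [isTrivialOnQ_iff] at h
  refine hω (MonoidHom.ext fun x ↦ (hker x).2 ?_)
  obtain ⟨z, hz⟩ := exists_norm_eq_of_forall_ramified hK hθ hd (fun u hu hui ↦ by
    obtain ⟨y, hy⟩ := (hker (Units.mk0 u hu.ne_zero)).1
      (h (Units.mk0 u hu.ne_zero) hu (hui.mono (by omega)))
    exact ⟨y, congrArg Units.val hy⟩) x.ne_zero
  obtain ⟨y, -, hy⟩ := exists_unit_norm_eq hK hz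
  exact ⟨y, hy⟩

end Ramified

end Conductor

/-- Let `K/ℚ_p` be quadratic with residue degree `f` (so `e·f = 2`), and
let `ω` be the character of order `2` of `ℚ_p^×` with kernel exactly the norm group
`N_{K/ℚ_p}(K^×)`.  Then for every character `χ` of `ℚ_p^×` one has
`f · a(χ ∘ N_{K/ℚ_p}) = a(χ) + a(χω) − a(ω)`. -/
theorem conductor_norm_formula (p : ℕ) [Fact p.Prime] (K : Type*) [Field K]
    [Algebra ℚ_[p] K] (hquad : Module.finrank ℚ_[p] K = 2) (D : PadicValData p K)
    (f : ℕ) (hf : D.e * f = 2)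
    (ω : (ℚ_[p])ˣ →* ℂˣ) (hωchar : ∃ i, IsTrivialOnQ p ω i)
    (hω_ne : ω ≠ 1) (hω_sq : ω ^ 2 = 1)
    (hker : ∀ x : (ℚ_[p])ˣ, ω x = 1 ↔
      ∃ y : Kˣ, Units.map (Algebra.norm ℚ_[p] : K →* ℚ_[p]) y = x)
    (χ : (ℚ_[p])ˣ →* ℂˣ) (hχ : ∃ i, IsTrivialOnQ p χ i) :
    (f : ℤ) * condK D (χ.comp (Units.map (Algebra.norm ℚ_[p] : K →* ℚ_[p])))
      = condQ p χ + condQ p (χ * ω) - condQ p ω := by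
  set κ := χ.comp (Units.map (Algebra.norm ℚ_[p] : K →* ℚ_[p]))
  have hχω : ∃ i, IsTrivialOnQ p (χ * ω) i := by
    obtain ⟨i, hi⟩ := hχ
    obtain ⟨j, hj⟩ := hωchar
    exact ⟨max i j, (hi.mono (le_max_left i j)).mul (hj.mono (le_max_right i j))⟩
  have hωω : χ * ω * ω = χ := by
    ext1 x
    have h : ω x ^ 2 = 1 := by rw [← MonoidHom.pow_apply, hω_sq, MonoidHom.one_apply]
    rw [MonoidHom.mul_apply, MonoidHom.mul_apply, mul_assoc, ← sq, h, mul_one]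
  have hχ_le : ∀ n, condQ p ω ≤ n → (condQ p χ ≤ n ↔ condQ p (χ * ω) ≤ n) := by
    intro n hn
    rw [condQ_le_iff hχ, condQ_le_iff hχω]
    rw [condQ_le_iff hωchar] at hn
    refine ⟨fun h ↦ h.mul hn, fun h ↦ ?_⟩
    have := h.mul hn
    rwa [hωω] at this
  have hω_le : ∀ n, condQ p χ ≤ n → condQ p (χ * ω) ≤ n → condQ p ω ≤ n := by
    intro n h1 h2
    rw [condQ_le_iff hχ] at h1
    rw [condQ_le_iff hχω] at h2
    rw [condQ_le_iff hωchar]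
    intro u hu hui
    have := h2 u hu hui
    rwa [MonoidHom.mul_apply, h1 u hu hui, one_mul] at this
  have hf12 : f = 1 ∨ f = 2 := (Nat.dvd_prime Nat.prime_two).1 ⟨D.e, by rw [← hf, mul_comm]⟩
  rcases hf12 with rfl | rfl
  · obtain ⟨θ, hθ0, hθv⟩ := D.v_surj 1
    have hθ := D.valEq_norm hquad hf hθ0
    rw [hθv, Nat.cast_one, one_mul] at hθ
    obtain ⟨d', hd'⟩ := exists_valEq_discr hθ
    obtain ⟨d, rfl⟩ : ∃ d : ℕ, d' = d := Int.eq_ofNat_of_zero_le (by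
      rcases valEq_discr_cases hquad hθ hd' with ⟨k, hk, h, -⟩ | ⟨k, hk, h, -⟩ <;> omega)
    have hge := isTrivialOnK_comp_norm_iff_of_ramified_of_ge hquad D hf hθ hd' χ
    have hωd := condQ_eq_of_ramified hquad hθ hd' hω_ne hker
    have hκex : ∃ i, IsTrivialOnK D κ i := by
      obtain ⟨i, hi⟩ := hχ
      exact ⟨d + 2 * i, (hge (2 * i)).2 (hi.mono (by omega))⟩
    have hC_le : ∀ i ≤ d, (condK D κ ≤ i ↔ condQ p χ ≤ i ∨ condQ p (χ * ω) ≤ i) := by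
      intro i hi
      rw [condQ_le_iff hχ, condQ_le_iff hχω, condK_le_iff hκex]
      exact isTrivialOnK_comp_norm_iff_of_ramified_of_le hquad D hf hθ hd' hω_sq hker hi
    have hC_ge : ∀ k, (condK D κ ≤ d + k ↔ condQ p χ ≤ d + k / 2) := by
      intro k
      rw [condQ_le_iff hχ, condK_le_iff hκex]
      exact hge k
    rw [hωd] at hχ_le hω_le ⊢
    generalize condQ p χ = A at *
    generalize condQ p (χ * ω) = B at *
    generalize condK D κ = C at *
    rcases le_or_gt A d with hA | hA
    · have := hω_le (max A B)
      have := hχ_le d le_rfl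
      have := hC_le A
      have := hC_le B
      have := hC_le C
      have := hC_ge 0
      omega
    · have := hχ_le d le_rfl
      have := hχ_le A
      have := hχ_le B
      have := hC_ge 0
      have := hC_ge (2 * (A - d))
      have := hC_ge (C - d)
      omega
  · have hiff := isTrivialOnK_comp_norm_iff_of_unramified hquad D hf
    have hω0 : condQ p ω = 0 := by
      rw [← Nat.le_zero, condQ_le_iff hωchar, ← hiff]
      exact fun u _ _ ↦ (hker _).2 ⟨u, rfl⟩
    have hC : condK D κ = condQ p χ := by
      have hset : {i | IsTrivialOnK D κ i} = {i | IsTrivialOnQ p χ i} := Set.ext (hiff χ)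
      rw [condK, hset, condQ]
    have h1 := hχ_le (condQ p χ) (by omega)
    have h2 := hχ_le (condQ p (χ * ω)) (by omega)
    rw [hC, hω0]
    push_cast
    omega
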